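/- Let X, Y, Z > 0, α, β ∈ (0,1) and φ₁, φ₂ ∈ (−π, π). Then, as ε → 0+, ∫₀^{∞}∫₀^{∞} V(ε, −u₁, u₂) du₁ du₂ = ∫₀^{∞}∫₀^{∞} V(0, −u₁, u₂) du₁ du₂ + Γ(−α) ( ∫₀^{∞} (Z e^{−u} + X)^{α} exp(−Y e^{u}) · e^{βu}/(1 + e^{u + iφ₂}) du ) ε^{α} + O(ε). -/

import Mathlib

/-- The function `V(ε,u₁,u₂)` from Appendix B:
`V(ε,u₁,u₂) = exp(−(Xe^{u₁}+Ye^{u₂}+Ze^{u₁+u₂}) − 2ε(X cosh u₁ + Y cosh u₂ + Z cosh(u₁+u₂)))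
  · e^{αu₁+βu₂} / ((1+e^{u₁+iφ₁})(1+e^{u₂+iφ₂}))`. -/
noncomputable def Vfun (X Y Z α β φ₁ φ₂ ε u₁ u₂ : ℝ) : ℂ :=
  (Real.exp (-(X * Real.exp u₁ + Y * Real.exp u₂ + Z * Real.exp (u₁ + u₂))
      - 2 * ε * (X * Real.cosh u₁ + Y * Real.cosh u₂ + Z * Real.cosh (u₁ + u₂))) : ℂ) *
    Complex.exp ((α : ℂ) * (u₁ : ℂ) + (β : ℂ) * (u₂ : ℂ)) /
      ((1 + Complex.exp ((u₁ : ℂ) + Complex.I * (φ₁ : ℂ))) *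
        (1 + Complex.exp ((u₂ : ℂ) + Complex.I * (φ₂ : ℂ))))

open MeasureTheory Set Filter Topology

theorem abs_exp_neg_sub_one_le {t : ℝ} (ht : 0 ≤ t) : |Real.exp (-t) - 1| ≤ t := by
  rw [abs_sub_comm, abs_of_nonneg (by simpa using ht)]
  linarith [Real.add_one_le_exp (-t)]

theorem abs_exp_neg_sub_one_le_one {t : ℝ} (ht : 0 ≤ t) : |Real.exp (-t) - 1| ≤ 1 := by
  rw [abs_sub_comm, abs_of_nonneg (by simpa using ht)]
  linarith [Real.exp_pos (-t)]

theorem abs_rpow_mul_exp_neg_sub_one_le (α : ℝ) {t : ℝ} (ht : 0 < t) :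
    |t ^ (-α - 1) * (Real.exp (-t) - 1)| ≤ t ^ (-α) := by
  rw [abs_mul, abs_of_pos (Real.rpow_pos_of_pos ht _)]
  calc t ^ (-α - 1) * |Real.exp (-t) - 1| ≤ t ^ (-α - 1) * t := by
        gcongr
        exact abs_exp_neg_sub_one_le ht.le
    _ = t ^ (-α) := by
        rw [← Real.rpow_add_one ht.ne']
        simp

theorem integrableOn_rpow_mul_exp_neg_sub_one {α : ℝ} (hα0 : 0 < α) (hα1 : α < 1) :
    IntegrableOn (fun t : ℝ => t ^ (-α - 1) * (Real.exp (-t) - 1)) (Ioi 0) := by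
  have hm (s : Set ℝ) : AEStronglyMeasurable
      (fun t : ℝ => t ^ (-α - 1) * (Real.exp (-t) - 1)) (volume.restrict s) := by
    apply Measurable.aestronglyMeasurable
    fun_prop
  rw [← Ioc_union_Ioi_eq_Ioi zero_le_one]
  refine IntegrableOn.union ?_ ?_
  · have h := intervalIntegral.intervalIntegrable_rpow' (a := 0) (b := 1) (r := -α) (by linarith)
    rw [intervalIntegrable_iff_integrableOn_Ioc_of_le zero_le_one] at h
    refine h.mono' (hm _) ?_
    filter_upwards [ae_restrict_mem measurableSet_Ioc] with t ht
    exact abs_rpow_mul_exp_neg_sub_one_le α ht.1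
  · have h := integrableOn_Ioi_rpow_of_lt (a := -α - 1) (c := 1) (by linarith) one_pos
    refine h.mono' (hm _) ?_
    filter_upwards [ae_restrict_mem measurableSet_Ioi] with t ht
    have ht0 : (0 : ℝ) < t := one_pos.trans ht
    rw [Real.norm_eq_abs, abs_mul, abs_of_pos (Real.rpow_pos_of_pos ht0 _)]
    exact mul_le_of_le_one_right (Real.rpow_nonneg ht0.le _) (abs_exp_neg_sub_one_le_one ht0.le)

/-- The Cauchy–Saalschütz representation of the Gamma function on `(-1, 0)`. -/
theorem Gamma_neg_eq_integral {α : ℝ} (hα0 : 0 < α) (hα1 : α < 1) :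
    Real.Gamma (-α) = ∫ t in Ioi (0 : ℝ), t ^ (-α - 1) * (Real.exp (-t) - 1) := by
  have hG : Real.Gamma (1 - α) = -α * Real.Gamma (-α) := by
    rw [← Real.Gamma_add_one (by linarith)]
    ring_nf
  have hI := Real.Gamma_eq_integral (s := 1 - α) (by linarith)
  have hc := Real.GammaIntegral_convergent (s := 1 - α) (by linarith)
  rw [show (1 : ℝ) - α - 1 = -α by ring] at hI hc
  have hparts := integral_Ioi_mul_deriv_eq_deriv_mul (a := (0 : ℝ)) (a' := 0) (b' := 0)
    (u := fun t : ℝ => Real.exp (-t) - 1) (u' := fun t => -Real.exp (-t))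
    (v := fun t : ℝ => t ^ (-α)) (v' := fun t => -α * t ^ (-α - 1))
    (fun t _ => by simpa using ((hasDerivAt_neg t).exp.sub_const 1))
    (fun t ht => Real.hasDerivAt_rpow_const (Or.inl (ne_of_gt ht)))
    (((integrableOn_rpow_mul_exp_neg_sub_one hα0 hα1).const_mul (-α)).congr
      (ae_of_all _ fun t => by simp only [Pi.mul_apply]; ring))
    (hc.neg.congr (ae_of_all _ fun t => by simp))
    (by
      have h0 : Tendsto (fun t : ℝ => t ^ (1 - α)) (𝓝[>] 0) (𝓝 0) := by
        have := (Real.continuousAt_rpow_const (0 : ℝ) (1 - α) (Or.inr (by linarith))).tendsto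
        rw [Real.zero_rpow (by linarith)] at this
        exact this.mono_left nhdsWithin_le_nhds
      refine squeeze_zero_norm' ?_ h0
      filter_upwards [self_mem_nhdsWithin] with t ht
      have ht0 : (0 : ℝ) < t := ht
      simp only [Pi.mul_apply]
      rw [norm_mul, Real.norm_eq_abs, Real.norm_of_nonneg (Real.rpow_nonneg ht0.le _),
        sub_eq_add_neg 1 α, Real.rpow_add ht0, Real.rpow_one]
      gcongr
      exact abs_exp_neg_sub_one_le ht0.le)
    (by
      refine squeeze_zero_norm' ?_ (tendsto_rpow_neg_atTop hα0)
      filter_upwards [eventually_gt_atTop 0] with t ht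
      simp only [Pi.mul_apply]
      rw [norm_mul, Real.norm_eq_abs, Real.norm_of_nonneg (Real.rpow_nonneg ht.le _)]
      exact mul_le_of_le_one_left (Real.rpow_nonneg ht.le _) (abs_exp_neg_sub_one_le_one ht.le))
  have h1 : ∫ t in Ioi (0 : ℝ), (Real.exp (-t) - 1) * (-α * t ^ (-α - 1))
      = -α * ∫ t in Ioi (0 : ℝ), t ^ (-α - 1) * (Real.exp (-t) - 1) := by
    rw [← integral_const_mul]
    congr 1 with t
    ring
  have h2 : ∫ t in Ioi (0 : ℝ), -Real.exp (-t) * t ^ (-α) = -Real.Gamma (1 - α) := by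
    rw [hI, ← integral_neg]
    congr 1 with t
    ring
  rw [h1, h2, hG] at hparts
  have : α * (Real.Gamma (-α) - ∫ t in Ioi (0 : ℝ), t ^ (-α - 1) * (Real.exp (-t) - 1)) = 0 := by
    linarith
  rcases mul_eq_zero.mp this with h | h <;> linarith

theorem integral_exp_mul_exp_neg_mul_exp_sub_one (α : ℝ) {s : ℝ} (hs : 0 < s) :
    ∫ a in Ioi (0 : ℝ), Real.exp (-α * a) * (Real.exp (-(s * Real.exp a)) - 1)
      = s ^ α * ∫ t in Ioi s, t ^ (-α - 1) * (Real.exp (-t) - 1) := by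
  have himage : (fun a : ℝ => s * Real.exp a) '' Ioi 0 = Ioi s := by
    ext t
    constructor
    · rintro ⟨a, ha, rfl⟩
      exact lt_mul_of_one_lt_right hs (Real.one_lt_exp_iff.mpr ha)
    · intro ht
      have ht : s < t := ht
      refine ⟨Real.log (t / s), Real.log_pos ((one_lt_div hs).mpr ht), ?_⟩
      simp only [Real.exp_log (div_pos (hs.trans ht) hs)]
      field_simp
  have h := integral_image_eq_integral_abs_deriv_smul (s := Ioi (0 : ℝ))
    (f := fun a => s * Real.exp a) (f' := fun a => s * Real.exp a) measurableSet_Ioi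
    (fun a _ => ((Real.hasDerivAt_exp a).const_mul s).hasDerivWithinAt)
    (fun a _ b _ hab => Real.exp_injective (mul_left_cancel₀ hs.ne' hab))
    (fun t : ℝ => t ^ (-α - 1) * (Real.exp (-t) - 1))
  rw [himage] at h
  rw [h, ← integral_const_mul]
  congr 1 with a
  have hpos : 0 < s * Real.exp a := mul_pos hs (Real.exp_pos a)
  have hcancel : s ^ α * s ^ (-α) = 1 := by
    rw [← Real.rpow_add hs, add_neg_cancel, Real.rpow_zero]
  rw [abs_of_pos hpos, smul_eq_mul, ← mul_assoc, ← mul_assoc, mul_assoc (s ^ α), mul_comm _ (_ ^ _),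
    ← Real.rpow_add_one hpos.ne', sub_add_cancel, Real.mul_rpow hs.le (Real.exp_pos a).le,
    ← mul_assoc, hcancel, one_mul, ← Real.exp_mul, mul_comm a]

theorem abs_integral_exp_mul_exp_neg_mul_exp_sub_one_sub_le {α : ℝ} (hα0 : 0 < α) (hα1 : α < 1)
    {s : ℝ} (hs : 0 < s) :
    |(∫ a in Ioi (0 : ℝ), Real.exp (-α * a) * (Real.exp (-(s * Real.exp a)) - 1))
      - Real.Gamma (-α) * s ^ α| ≤ s / (1 - α) := by
  have hint := integrableOn_rpow_mul_exp_neg_sub_one hα0 hα1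
  have hsplit : Real.Gamma (-α) = (∫ t in Ioc 0 s, t ^ (-α - 1) * (Real.exp (-t) - 1))
      + ∫ t in Ioi s, t ^ (-α - 1) * (Real.exp (-t) - 1) := by
    rw [Gamma_neg_eq_integral hα0 hα1, ← Ioc_union_Ioi_eq_Ioi hs.le]
    exact setIntegral_union (Ioc_disjoint_Ioi le_rfl) measurableSet_Ioi
      (hint.mono_set Ioc_subset_Ioi_self) (hint.mono_set (Ioi_subset_Ioi hs.le))
  have hsmall : |∫ t in Ioc 0 s, t ^ (-α - 1) * (Real.exp (-t) - 1)| ≤ s ^ (1 - α) / (1 - α) := by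
    have h := intervalIntegral.intervalIntegrable_rpow' (a := 0) (b := s) (r := -α) (by linarith)
    rw [intervalIntegrable_iff_integrableOn_Ioc_of_le hs.le] at h
    have hle := norm_integral_le_of_norm_le h (f := fun t => t ^ (-α - 1) * (Real.exp (-t) - 1)) (by
      filter_upwards [ae_restrict_mem measurableSet_Ioc] with t ht
      exact abs_rpow_mul_exp_neg_sub_one_le α ht.1)
    rw [← intervalIntegral.integral_of_le hs.le (f := fun t : ℝ => t ^ (-α)),
      integral_rpow (Or.inl (by linarith)),
      Real.zero_rpow (by linarith), sub_zero, neg_add_eq_sub] at hle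
    exact hle
  have hpow : s ^ α * s ^ (1 - α) = s := by
    rw [← Real.rpow_add hs, add_sub_cancel, Real.rpow_one]
  rw [integral_exp_mul_exp_neg_mul_exp_sub_one α hs, hsplit, abs_sub_comm, mul_comm (_ + _),
    ← mul_sub, add_sub_cancel_right, abs_mul, abs_of_pos (Real.rpow_pos_of_pos hs _)]
  calc s ^ α * _ ≤ s ^ α * (s ^ (1 - α) / (1 - α)) := by gcongr
    _ = s / (1 - α) := by rw [← mul_div_assoc, hpow]

theorem cos_half_le_norm_one_add_exp (x φ : ℝ) :
    Real.cos (φ / 2) ≤ ‖1 + Complex.exp ((x : ℂ) + Complex.I * (φ : ℂ))‖ := by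
  refine Real.le_sqrt_of_sq_le ?_
  have hk : Real.cos φ = 2 * Real.cos (φ / 2) ^ 2 - 1 := by
    rw [← Real.cos_two_mul]
    ring_nf
  have hk1 := Real.cos_sq_le_one (φ / 2)
  have hsc := Real.sin_sq_add_cos_sq φ
  have hr := Real.exp_pos x
  rw [Complex.normSq_apply]
  simp only [Complex.add_re, Complex.add_im, Complex.one_re, Complex.one_im, Complex.exp_re,
    Complex.exp_im, Complex.ofReal_re, Complex.ofReal_im, Complex.mul_re, Complex.mul_im,
    Complex.I_re, Complex.I_im]
  simp only [zero_mul, one_mul, mul_zero, sub_zero, add_zero, zero_add]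
  have hexp : (1 + Real.exp x * Real.cos φ) * (1 + Real.exp x * Real.cos φ)
      + Real.exp x * Real.sin φ * (Real.exp x * Real.sin φ)
      = 1 + 2 * Real.exp x * Real.cos φ + Real.exp x ^ 2 := by
    linear_combination Real.exp x ^ 2 * hsc
  rw [hexp, hk]
  nlinarith [mul_nonneg (sub_nonneg.mpr hk1) (sq_nonneg (1 - Real.exp x)),
    mul_nonneg (sq_nonneg (Real.cos (φ / 2))) hr.le,
    mul_nonneg (sq_nonneg (Real.cos (φ / 2))) (sq_nonneg (Real.exp x))]

theorem cos_half_pos {φ : ℝ} (hφ : φ ∈ Ioo (-Real.pi) Real.pi) : 0 < Real.cos (φ / 2) :=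
  Real.cos_pos_of_mem_Ioo ⟨by linarith [hφ.1], by linarith [hφ.2]⟩

theorem one_add_exp_ne_zero (x : ℝ) {φ : ℝ} (hφ : φ ∈ Ioo (-Real.pi) Real.pi) :
    1 + Complex.exp ((x : ℂ) + Complex.I * (φ : ℂ)) ≠ 0 :=
  norm_pos_iff.mp ((cos_half_pos hφ).trans_le (cos_half_le_norm_one_add_exp x φ))

/-- The factor of `Vfun` that only depends on the second variable. -/
noncomputable def Vtail (Y β φ b : ℝ) : ℂ :=
  (Real.exp (-(Y * Real.exp b)) : ℂ) * Complex.exp ((β : ℂ) * (b : ℂ)) /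
    (1 + Complex.exp ((b : ℂ) + Complex.I * (φ : ℂ)))

/-- The factor of `Vfun` at `(-a, b)` that tends to `1` as `a → ∞`. -/
noncomputable def Vhead (X Z φ a b : ℝ) : ℂ :=
  (Real.exp (-(Real.exp (-a) * (X + Z * Real.exp b))) : ℂ) /
    (1 + Complex.exp (((-a : ℝ) : ℂ) + Complex.I * (φ : ℂ)))

theorem Vfun_neg_eq (X Y Z α β φ₁ φ₂ ε a b : ℝ) :
    Vfun X Y Z α β φ₁ φ₂ ε (-a) b =
      ((Real.exp (-α * a) * (Real.exp (-(ε * (Z * Real.exp (-b) + X) * Real.exp a)) *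
        Real.exp (-(ε * (X * Real.exp (-a) + Y * Real.exp b + Y * Real.exp (-b)
          + Z * Real.exp (b - a))))) : ℝ) : ℂ) * Vhead X Z φ₁ a b * Vtail Y β φ₂ b := by
  have hexp : Real.exp (-(X * Real.exp (-a) + Y * Real.exp b + Z * Real.exp (-a + b))
      - 2 * ε * (X * Real.cosh (-a) + Y * Real.cosh b + Z * Real.cosh (-a + b)))
      = Real.exp (-(ε * (Z * Real.exp (-b) + X) * Real.exp a)) *
        Real.exp (-(ε * (X * Real.exp (-a) + Y * Real.exp b + Y * Real.exp (-b)
          + Z * Real.exp (b - a)))) * Real.exp (-(Real.exp (-a) * (X + Z * Real.exp b)))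
        * Real.exp (-(Y * Real.exp b)) := by
    rw [← Real.exp_add, ← Real.exp_add, ← Real.exp_add]
    congr 1
    simp only [Real.cosh_eq, sub_eq_add_neg, neg_add, neg_neg, Real.exp_add]
    ring
  have hα : Complex.exp ((α : ℂ) * ((-a : ℝ) : ℂ) + (β : ℂ) * (b : ℂ))
      = (Real.exp (-α * a) : ℂ) * Complex.exp ((β : ℂ) * (b : ℂ)) := by
    rw [Complex.exp_add]
    push_cast
    ring_nf
  unfold Vfun Vhead Vtail
  rw [hexp, hα]
  simp only [div_eq_mul_inv, mul_inv]
  push_cast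
  ring

theorem exists_norm_Vtail_le {Y β φ : ℝ} (hY : 0 < Y) (hβ1 : β < 1)
    (hφ : φ ∈ Ioo (-Real.pi) Real.pi) :
    ∃ K, 0 < K ∧ ∀ b, 0 < b → ‖Vtail Y β φ b‖ ≤ K * Real.exp (-3 * b) := by
  have hc := cos_half_pos hφ
  refine ⟨24 / Y ^ 4 / Real.cos (φ / 2), by positivity, fun b hb => ?_⟩
  have h1 : Real.exp (-(Y * Real.exp b)) ≤ 24 / Y ^ 4 * Real.exp (-4 * b) := by
    have h := Real.pow_div_factorial_le_exp (Y * Real.exp b) (by positivity) 4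
    have hE : Real.exp (-4 * b) = (Real.exp b ^ 4)⁻¹ := by
      rw [← Real.exp_nat_mul, ← Real.exp_neg]
      push_cast
      ring_nf
    rw [Real.exp_neg, hE]
    calc (Real.exp (Y * Real.exp b))⁻¹ ≤ ((Y * Real.exp b) ^ 4 / (Nat.factorial 4 : ℕ))⁻¹ := by
          gcongr
      _ = 24 / Y ^ 4 * (Real.exp b ^ 4)⁻¹ := by
          rw [show Nat.factorial 4 = 24 from rfl]
          push_cast
          field_simp
  have h2 : ‖Complex.exp ((β : ℂ) * (b : ℂ))‖ ≤ Real.exp b := by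
    rw [Complex.norm_exp, ← Complex.ofReal_mul, Complex.ofReal_re]
    gcongr
    exact mul_le_of_le_one_left hb.le hβ1.le
  unfold Vtail
  rw [norm_div, norm_mul, Complex.norm_real, Real.norm_of_nonneg (Real.exp_pos _).le]
  calc _ ≤ 24 / Y ^ 4 * Real.exp (-4 * b) * Real.exp b / Real.cos (φ / 2) := by
        gcongr
        exact cos_half_le_norm_one_add_exp b φ
    _ = _ := by
        rw [mul_assoc, ← Real.exp_add]
        ring_nf

theorem norm_Vhead_le {X Z φ : ℝ} (hX : 0 < X) (hZ : 0 < Z)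
    (hφ : φ ∈ Ioo (-Real.pi) Real.pi) (a b : ℝ) :
    ‖Vhead X Z φ a b‖ ≤ 1 / Real.cos (φ / 2) := by
  unfold Vhead
  rw [norm_div, Complex.norm_real, Real.norm_of_nonneg (Real.exp_pos _).le]
  have hc := cos_half_pos hφ
  gcongr
  · rw [Real.exp_le_one_iff, neg_nonpos]
    positivity
  · exact cos_half_le_norm_one_add_exp _ φ

theorem norm_Vhead_sub_one_le {X Z φ : ℝ} (hX : 0 < X) (hZ : 0 < Z)
    (hφ : φ ∈ Ioo (-Real.pi) Real.pi) (a : ℝ) {b : ℝ} (hb : 0 < b) :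
    ‖Vhead X Z φ a b - 1‖
      ≤ Real.exp (-a) * ((X + Z + 1) * Real.exp b) / Real.cos (φ / 2) := by
  have hc := cos_half_pos hφ
  have hb1 : 1 ≤ Real.exp b := Real.one_le_exp hb.le
  have hx : 0 ≤ Real.exp (-a) * (X + Z * Real.exp b) := by positivity
  unfold Vhead
  rw [div_sub_one (one_add_exp_ne_zero _ hφ), norm_div]
  gcongr
  · have hsplit : ((Real.exp (-(Real.exp (-a) * (X + Z * Real.exp b))) : ℝ) : ℂ)
        - (1 + Complex.exp (((-a : ℝ) : ℂ) + Complex.I * (φ : ℂ)))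
        = ((Real.exp (-(Real.exp (-a) * (X + Z * Real.exp b))) - 1 : ℝ) : ℂ)
          - Complex.exp (((-a : ℝ) : ℂ) + Complex.I * (φ : ℂ)) := by
      push_cast
      ring
    rw [hsplit]
    refine (norm_sub_le _ _).trans ?_
    rw [Complex.norm_real, Real.norm_eq_abs, Complex.norm_exp]
    simp only [Complex.add_re, Complex.ofReal_re, Complex.mul_re, Complex.I_re, Complex.I_im,
      Complex.ofReal_im, zero_mul, mul_zero, sub_zero, add_zero]
    calc _ ≤ Real.exp (-a) * (X + Z * Real.exp b) + Real.exp (-a) := by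
          gcongr
          exact abs_exp_neg_sub_one_le hx
      _ = Real.exp (-a) * (X * 1 + Z * Real.exp b + 1) := by ring
      _ ≤ Real.exp (-a) * (X * Real.exp b + Z * Real.exp b + Real.exp b) := by gcongr
      _ = _ := by ring
  · exact cos_half_le_norm_one_add_exp _ φ

theorem continuous_Vtail (Y β : ℝ) {φ : ℝ} (hφ : φ ∈ Ioo (-Real.pi) Real.pi) :
    Continuous (Vtail Y β φ) := by
  unfold Vtail
  exact Continuous.div (by fun_prop) (by fun_prop) fun b => one_add_exp_ne_zero b hφ

theorem continuous_Vhead (X Z : ℝ) {φ : ℝ} (hφ : φ ∈ Ioo (-Real.pi) Real.pi) :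
    Continuous fun p : ℝ × ℝ => Vhead X Z φ p.1 p.2 := by
  unfold Vhead
  exact Continuous.div (by fun_prop) (by fun_prop) fun p => one_add_exp_ne_zero (-p.1) hφ

theorem continuous_Vfun_neg (X Y Z α β ε : ℝ) {φ₁ φ₂ : ℝ} (hφ₁ : φ₁ ∈ Ioo (-Real.pi) Real.pi)
    (hφ₂ : φ₂ ∈ Ioo (-Real.pi) Real.pi) :
    Continuous fun p : ℝ × ℝ => Vfun X Y Z α β φ₁ φ₂ ε (-p.1) p.2 := by
  simp only [Vfun_neg_eq]
  exact (Continuous.mul (by fun_prop) (continuous_Vhead X Z hφ₁)).mul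
    ((continuous_Vtail Y β hφ₂).comp continuous_snd)

theorem exp_neg_mul_le_one {ε x : ℝ} (hε : 0 ≤ ε) (hx : 0 ≤ x) : Real.exp (-(ε * x)) ≤ 1 := by
  rw [Real.exp_le_one_iff, neg_nonpos]
  positivity

theorem norm_Vfun_neg_le {X Y Z : ℝ} (hX : 0 < X) (hY : 0 < Y) (hZ : 0 < Z) (α β : ℝ)
    {φ₁ : ℝ} (hφ₁ : φ₁ ∈ Ioo (-Real.pi) Real.pi) (φ₂ : ℝ) {ε : ℝ} (hε : 0 ≤ ε) (a b : ℝ) :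
    ‖Vfun X Y Z α β φ₁ φ₂ ε (-a) b‖
      ≤ Real.exp (-α * a) * (1 / Real.cos (φ₁ / 2)) * ‖Vtail Y β φ₂ b‖ := by
  rw [Vfun_neg_eq, norm_mul, norm_mul, Complex.norm_real, Real.norm_of_nonneg (by positivity)]
  gcongr
  · refine mul_le_of_le_one_right (Real.exp_pos _).le (mul_le_one₀ ?_ (Real.exp_pos _).le ?_)
    · rw [mul_assoc]
      exact exp_neg_mul_le_one hε (by positivity)
    · exact exp_neg_mul_le_one hε (by positivity)
  · exact norm_Vhead_le hX hZ hφ₁ a b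

/-- Replacing the head factor by `1` and dropping the terms of the regulator that stay bounded
as `a → ∞` changes `V(ε, -a, b) - V(0, -a, b)` by `O(ε)`. -/
theorem norm_Vfun_neg_sub_sub_le {X Y Z : ℝ} (hX : 0 < X) (hY : 0 < Y) (hZ : 0 < Z) (α β : ℝ)
    {φ₁ : ℝ} (hφ₁ : φ₁ ∈ Ioo (-Real.pi) Real.pi) (φ₂ : ℝ) {ε : ℝ} (hε : 0 ≤ ε) {a b : ℝ}
    (ha : 0 < a) (hb : 0 < b) :
    ‖Vfun X Y Z α β φ₁ φ₂ ε (-a) b - Vfun X Y Z α β φ₁ φ₂ 0 (-a) b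
      - ((Real.exp (-α * a) * (Real.exp (-(ε * (Z * Real.exp (-b) + X) * Real.exp a)) - 1) : ℝ) : ℂ)
        * Vtail Y β φ₂ b‖
      ≤ Real.exp (-α * a) * (ε * Real.exp b * ((X + 2 * Y + Z + (Z + X) * (X + Z + 1))
          / Real.cos (φ₁ / 2))) * ‖Vtail Y β φ₂ b‖ := by
  have hc := cos_half_pos hφ₁
  have hb1 : 1 ≤ Real.exp b := Real.one_le_exp hb.le
  have hnb : Real.exp (-b) ≤ 1 := Real.exp_le_one_iff.mpr (by linarith)
  have hna : Real.exp (-a) ≤ 1 := Real.exp_le_one_iff.mpr (by linarith)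
  have hV := Vfun_neg_eq X Y Z α β φ₁ φ₂ ε a b
  have hV0 := Vfun_neg_eq X Y Z α β φ₁ φ₂ 0 a b
  simp only [zero_mul, neg_zero, Real.exp_zero, mul_one] at hV0
  set r := X * Real.exp (-a) + Y * Real.exp b + Y * Real.exp (-b) + Z * Real.exp (b - a) with hr
  have hr0 : 0 ≤ r := by positivity
  have hr1 : r ≤ (X + 2 * Y + Z) * Real.exp b := by
    have : Real.exp (b - a) ≤ Real.exp b := Real.exp_le_exp.mpr (by linarith)
    calc r ≤ X * Real.exp b + Y * Real.exp b + Y * Real.exp b + Z * Real.exp b := by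
          rw [hr]
          gcongr <;> linarith
      _ = _ := by ring
  set x := ε * (Z * Real.exp (-b) + X) * Real.exp a with hx
  have hx0 : 0 ≤ x := by positivity
  have hx1 : x ≤ ε * (Z + X) * Real.exp a := by
    calc x ≤ ε * (Z * 1 + X) * Real.exp a := by rw [hx]; gcongr
      _ = _ := by ring
  set h := Vhead X Z φ₁ a b
  set g := Vtail Y β φ₂ b
  have hsplit : Vfun X Y Z α β φ₁ φ₂ ε (-a) b - Vfun X Y Z α β φ₁ φ₂ 0 (-a) b
      - ((Real.exp (-α * a) * (Real.exp (-x) - 1) : ℝ) : ℂ) * g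
      = ((Real.exp (-α * a) : ℝ) : ℂ) * (((Real.exp (-x) * (Real.exp (-(ε * r)) - 1) : ℝ) : ℂ) * h
        + ((Real.exp (-x) - 1 : ℝ) : ℂ) * (h - 1)) * g := by
    rw [hV, hV0]
    push_cast
    ring
  rw [hsplit, norm_mul, norm_mul, Complex.norm_real, Real.norm_of_nonneg (Real.exp_pos _).le]
  gcongr
  refine (norm_add_le _ _).trans ?_
  rw [norm_mul, norm_mul, Complex.norm_real, Complex.norm_real, Real.norm_eq_abs, Real.norm_eq_abs,
    abs_mul, abs_of_pos (Real.exp_pos _)]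
  have hhead : Real.exp (-x) * |Real.exp (-(ε * r)) - 1| * ‖h‖
      ≤ 1 * (ε * ((X + 2 * Y + Z) * Real.exp b)) * (1 / Real.cos (φ₁ / 2)) := by
    gcongr
    · exact Real.exp_le_one_iff.mpr (neg_nonpos.mpr hx0)
    · exact (abs_exp_neg_sub_one_le (by positivity)).trans (by gcongr)
    · exact norm_Vhead_le hX hZ hφ₁ a b
  have hdiff : |Real.exp (-x) - 1| * ‖h - 1‖ ≤ ε * (Z + X) * Real.exp a *
      (Real.exp (-a) * ((X + Z + 1) * Real.exp b) / Real.cos (φ₁ / 2)) := by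
    gcongr
    · exact (abs_exp_neg_sub_one_le hx0).trans hx1
    · exact norm_Vhead_sub_one_le hX hZ hφ₁ a hb
  refine (add_le_add hhead hdiff).trans_eq ?_
  have hcancel : Real.exp a * Real.exp (-a) = 1 := by rw [← Real.exp_add]; simp
  linear_combination (ε * (Z + X) * ((X + Z + 1) * Real.exp b) / Real.cos (φ₁ / 2)) * hcancel

theorem integrable_exp_mul_exp {α : ℝ} (hα0 : 0 < α) :
    Integrable (fun p : ℝ × ℝ => Real.exp (-α * p.1) * Real.exp (-2 * p.2))
      ((volume.restrict (Ioi 0)).prod (volume.restrict (Ioi 0))) :=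
  (exp_neg_integrableOn_Ioi 0 hα0).mul_prod (exp_neg_integrableOn_Ioi 0 two_pos)

theorem ae_prod_Ioi : ∀ᵐ p : ℝ × ℝ ∂((volume.restrict (Ioi 0)).prod (volume.restrict (Ioi 0))),
    0 < p.1 ∧ 0 < p.2 := by
  rw [Measure.prod_restrict]
  filter_upwards [ae_restrict_mem (measurableSet_Ioi.prod measurableSet_Ioi)] with p hp
  exact hp

theorem integrable_prod_Ioi_of_norm_le {α : ℝ} (hα0 : 0 < α) {F : ℝ × ℝ → ℂ} (hF : Continuous F)
    {K : ℝ} (hK : ∀ a b, 0 < a → 0 < b →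
      ‖F (a, b)‖ ≤ K * (Real.exp (-α * a) * Real.exp (-2 * b))) :
    Integrable F ((volume.restrict (Ioi 0)).prod (volume.restrict (Ioi 0))) := by
  refine ((integrable_exp_mul_exp hα0).const_mul K).mono' hF.aestronglyMeasurable ?_
  filter_upwards [ae_prod_Ioi] with p hp
  exact hK _ _ hp.1 hp.2

/-- Step 8 of Appendix B: as `ε → 0+`,
`∫₀^∞∫₀^∞ V(ε,−u₁,u₂) du₁du₂ = ∫₀^∞∫₀^∞ V(0,−u₁,u₂) du₁du₂
  + Γ(−α)(∫₀^∞ (Ze^{−u}+X)^α exp(−Ye^u) e^{βu}/(1+e^{u+iφ₂}) du) ε^α + O(ε)`. -/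
theorem Vfun_minusplus_asymptotics (X Y Z : ℝ) (hX : 0 < X) (hY : 0 < Y) (hZ : 0 < Z)
    (α β : ℝ) (hα0 : 0 < α) (hα1 : α < 1) (hβ0 : 0 < β) (hβ1 : β < 1) (φ₁ φ₂ : ℝ)
    (hφ₁ : φ₁ ∈ Set.Ioo (-Real.pi) Real.pi) (hφ₂ : φ₂ ∈ Set.Ioo (-Real.pi) Real.pi) :
    ∃ C ε₀ : ℝ, 0 < ε₀ ∧ ∀ ε : ℝ, 0 < ε → ε ≤ ε₀ →
      ‖(∫ u₁ in Set.Ioi (0:ℝ), ∫ u₂ in Set.Ioi (0:ℝ), Vfun X Y Z α β φ₁ φ₂ ε (-u₁) u₂)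
          - (∫ u₁ in Set.Ioi (0:ℝ), ∫ u₂ in Set.Ioi (0:ℝ), Vfun X Y Z α β φ₁ φ₂ 0 (-u₁) u₂)
          - ((Real.Gamma (-α) : ℝ) : ℂ) *
              (∫ u in Set.Ioi (0:ℝ), (((Z * Real.exp (-u) + X) ^ α : ℝ) : ℂ) *
                (Real.exp (-(Y * Real.exp u)) : ℂ) * Complex.exp ((β : ℂ) * (u : ℂ)) /
                  (1 + Complex.exp ((u : ℂ) + Complex.I * (φ₂ : ℂ)))) *
              ((ε ^ α : ℝ) : ℂ)‖
        ≤ C * ε := by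
  obtain ⟨K, hK0, hK⟩ := exists_norm_Vtail_le (β := β) hY hβ1 hφ₂
  have hc := cos_half_pos hφ₁
  have hα : 0 < 1 - α := by linarith
  have hK2 : ∀ b, 0 < b → ‖Vtail Y β φ₂ b‖ ≤ K * Real.exp (-2 * b) := fun b hb =>
    (hK b hb).trans (by gcongr; linarith)
  set μ : Measure (ℝ × ℝ) := (volume.restrict (Ioi 0)).prod (volume.restrict (Ioi 0))
  set M := (X + 2 * Y + Z + (Z + X) * (X + Z + 1)) / Real.cos (φ₁ / 2)
  have hV : ∀ ε, 0 ≤ ε → Integrable (fun p : ℝ × ℝ => Vfun X Y Z α β φ₁ φ₂ ε (-p.1) p.2) μ := by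
    intro ε hε
    refine integrable_prod_Ioi_of_norm_le hα0 (continuous_Vfun_neg X Y Z α β ε hφ₁ hφ₂)
      (K := 1 / Real.cos (φ₁ / 2) * K) fun a b _ hb => ?_
    calc _ ≤ Real.exp (-α * a) * (1 / Real.cos (φ₁ / 2)) * ‖Vtail Y β φ₂ b‖ :=
          norm_Vfun_neg_le hX hY hZ α β hφ₁ φ₂ hε a b
      _ ≤ Real.exp (-α * a) * (1 / Real.cos (φ₁ / 2)) * (K * Real.exp (-2 * b)) := by
          gcongr
          exact hK2 b hb
      _ = _ := by ring
  refine ⟨M * K * (∫ p, Real.exp (-α * p.1) * Real.exp (-2 * p.2) ∂μ)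
    + (Z + X) / (1 - α) * K * ∫ b in Ioi (0 : ℝ), Real.exp (-2 * b), 1, one_pos,
    fun ε hε _ => ?_⟩
  set W : ℝ → ℝ := fun b => Z * Real.exp (-b) + X with hW
  have hW0 : ∀ b, 0 < W b := fun b => by positivity
  have hW1 : ∀ b, 0 < b → W b ≤ Z + X := fun b hb => by
    have : Real.exp (-b) ≤ 1 := Real.exp_le_one_iff.mpr (by linarith)
    calc W b ≤ Z * 1 + X := by simp only [hW]; gcongr
      _ = Z + X := by ring
  set J : ℝ → ℝ := fun s =>
    ∫ a in Ioi (0 : ℝ), Real.exp (-α * a) * (Real.exp (-(s * Real.exp a)) - 1)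
  set P : ℝ × ℝ → ℂ := fun p =>
    ((Real.exp (-α * p.1) * (Real.exp (-(ε * W p.2 * Real.exp p.1)) - 1) : ℝ) : ℂ)
      * Vtail Y β φ₂ p.2 with hP
  have hPint : Integrable P μ := by
    refine integrable_prod_Ioi_of_norm_le hα0 (K := K) ?_ fun a b _ hb => ?_
    · exact Continuous.mul (by fun_prop) ((continuous_Vtail Y β hφ₂).comp continuous_snd)
    · simp only [hP]
      rw [norm_mul, Complex.norm_real, Real.norm_eq_abs, abs_mul, abs_of_pos (Real.exp_pos _)]
      have hx : 0 ≤ ε * W b * Real.exp a :=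
        mul_nonneg (mul_nonneg hε.le (hW0 b).le) (Real.exp_pos a).le
      calc _ ≤ Real.exp (-α * a) * 1 * (K * Real.exp (-2 * b)) := by
            gcongr
            · exact abs_exp_neg_sub_one_le_one hx
            · exact hK2 b hb
        _ = _ := by ring
  have hinner : ∀ b, ∫ a in Ioi (0 : ℝ), P (a, b) = (J (ε * W b) : ℂ) * Vtail Y β φ₂ b := by
    intro b
    simp only [hP]
    rw [integral_mul_const]
    congr 1
    exact integral_ofReal
  have hPeq : ∫ p, P p ∂μ = ∫ b in Ioi (0 : ℝ), (J (ε * W b) : ℂ) * Vtail Y β φ₂ b := by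
    rw [integral_prod_symm _ hPint]
    simp only [hinner]
  have hJint : IntegrableOn (fun b => (J (ε * W b) : ℂ) * Vtail Y β φ₂ b) (Ioi 0) := by
    have := hPint.integral_prod_right
    simp only [hinner] at this
    exact this
  have hTint : IntegrableOn (fun b => ((W b ^ α : ℝ) : ℂ) * Vtail Y β φ₂ b) (Ioi 0) := by
    refine ((exp_neg_integrableOn_Ioi 0 two_pos).const_mul ((Z + X) ^ α * K)).mono' ?_ ?_
    · refine (Continuous.mul ?_ (continuous_Vtail Y β hφ₂)).aestronglyMeasurable
      exact Complex.continuous_ofReal.comp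
        ((by fun_prop : Continuous W).rpow_const fun b => Or.inl (hW0 b).ne')
    · filter_upwards [ae_restrict_mem measurableSet_Ioi] with b hb
      rw [norm_mul, Complex.norm_real, Real.norm_of_nonneg (Real.rpow_nonneg (hW0 b).le _),
        mul_assoc]
      have := (hW0 b).le
      gcongr
      · exact hW1 b hb
      · exact hK2 b hb
  have hT : (∫ u in Ioi (0 : ℝ), (((Z * Real.exp (-u) + X) ^ α : ℝ) : ℂ) *
      (Real.exp (-(Y * Real.exp u)) : ℂ) * Complex.exp ((β : ℂ) * (u : ℂ)) /
        (1 + Complex.exp ((u : ℂ) + Complex.I * (φ₂ : ℂ))))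
      = ∫ b in Ioi (0 : ℝ), ((W b ^ α : ℝ) : ℂ) * Vtail Y β φ₂ b := by
    congr 1 with b
    simp only [hW, Vtail]
    ring
  rw [hT, ← integral_prod (fun p : ℝ × ℝ => Vfun X Y Z α β φ₁ φ₂ ε (-p.1) p.2) (hV ε hε.le),
    ← integral_prod (fun p : ℝ × ℝ => Vfun X Y Z α β φ₁ φ₂ 0 (-p.1) p.2) (hV 0 le_rfl)]
  have hregular : ‖∫ p : ℝ × ℝ, (Vfun X Y Z α β φ₁ φ₂ ε (-p.1) p.2
      - Vfun X Y Z α β φ₁ φ₂ 0 (-p.1) p.2 - P p) ∂μ‖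
      ≤ ε * M * K * ∫ p, Real.exp (-α * p.1) * Real.exp (-2 * p.2) ∂μ := by
    rw [← integral_const_mul]
    refine norm_integral_le_of_norm_le ((integrable_exp_mul_exp hα0).const_mul _) ?_
    filter_upwards [ae_prod_Ioi] with p hp
    calc _ ≤ Real.exp (-α * p.1) * (ε * Real.exp p.2 * M) * ‖Vtail Y β φ₂ p.2‖ :=
          norm_Vfun_neg_sub_sub_le hX hY hZ α β hφ₁ φ₂ hε.le hp.1 hp.2
      _ ≤ Real.exp (-α * p.1) * (ε * Real.exp p.2 * M) * (K * Real.exp (-3 * p.2)) := by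
          gcongr
          exact hK _ hp.2
      _ = ε * M * K * (Real.exp (-α * p.1) * (Real.exp p.2 * Real.exp (-3 * p.2))) := by ring
      _ = _ := by
          rw [← Real.exp_add p.2]
          ring_nf
  have hsingular : ‖∫ b in Ioi (0 : ℝ), ((J (ε * W b) : ℂ) * Vtail Y β φ₂ b
      - (Real.Gamma (-α) : ℂ) * ((ε ^ α : ℝ) : ℂ) * (((W b ^ α : ℝ) : ℂ) * Vtail Y β φ₂ b))‖
      ≤ ε * (Z + X) / (1 - α) * K * ∫ b in Ioi (0 : ℝ), Real.exp (-2 * b) := by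
    rw [← integral_const_mul]
    refine norm_integral_le_of_norm_le ((exp_neg_integrableOn_Ioi 0 two_pos).const_mul _) ?_
    filter_upwards [ae_restrict_mem measurableSet_Ioi] with b hb
    have hfactor : (J (ε * W b) : ℂ) * Vtail Y β φ₂ b
        - (Real.Gamma (-α) : ℂ) * ((ε ^ α : ℝ) : ℂ) * (((W b ^ α : ℝ) : ℂ) * Vtail Y β φ₂ b)
        = ((J (ε * W b) - Real.Gamma (-α) * (ε * W b) ^ α : ℝ) : ℂ) * Vtail Y β φ₂ b := by
      rw [Real.mul_rpow hε.le (hW0 b).le]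
      push_cast
      ring
    rw [hfactor, norm_mul, Complex.norm_real, Real.norm_eq_abs, mul_assoc]
    have hJle := abs_integral_exp_mul_exp_neg_mul_exp_sub_one_sub_le hα0 hα1 (mul_pos hε (hW0 b))
    gcongr
    · exact hJle.trans (by gcongr; exact hW1 b hb)
    · exact hK2 b hb
  rw [integral_sub (by exact (hV ε hε.le).sub (hV 0 le_rfl)) hPint,
    integral_sub (hV ε hε.le) (hV 0 le_rfl), hPeq] at hregular
  rw [integral_sub hJint (hTint.const_mul _), integral_const_mul] at hsingular
  refine le_trans (le_of_eq ?_) ((norm_add_le _ _).trans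
    ((add_le_add hregular hsingular).trans_eq ?_))
  · congr 1
    ring
  · ring
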